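/- Let IM = {(x,y) ∈ TM : F(x,y) = 1} be the indicatrix bundle of a Finsler manifold (M,F), viewed as a Riemannian submanifold of (TM,G) with the restricted metric Ḡ. The second fundamental form H of IM in TM satisfies H(∂̄/∂̄y^a, ∂̄/∂̄y^b) = −(1/F²) g_{ab} L, and H vanishes on all other pairs among the frame vectors δ̄/δ̄x^a, ξ, ∂̄/∂̄y^b; equivalently, ∇_X Y is tangent to IM for all such pairs (X,Y) except (∂̄/∂̄y^a, ∂̄/∂̄y^b), so the induced Levi-Civita connection ∇̄ of Ḡ agrees with ∇ on those pairs. -/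

import Mathlib

/-!
A local-coordinate framework for the geometry of the tangent bundle `TM` of an
`n`-dimensional Finsler manifold `(M, F)`, following the paper
"A frame on tangent bundle of a Finsler manifold and the natural foliations".

All geometric objects are described through their components on a chart domain
`U` of `TM` (avoiding the zero section): a point `p : Pt n` is the pair of
coordinates `(x^i, y^i)`, and a vector field on `TM` is given by its
components in the natural frame `(∂/∂x^i, ∂/∂y^i)`.
-/

open scoped BigOperators

noncomputable section

namespace FinslerFoliations

/-- A point of the tangent bundle `TM` in local coordinates:
`p.1 = (x^i)` is the base point and `p.2 = (y^i)` is the fibre coordinate. -/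
abbrev Pt (n : ℕ) : Type := (Fin n → ℝ) × (Fin n → ℝ)

/-- A (local) vector field on `TM`, given by its components in the natural
frame: `(X p).1 i` is the coefficient of `∂/∂x^i` and `(X p).2 i` the one of
`∂/∂y^i`. -/
abbrev VF (n : ℕ) : Type := Pt n → Pt n

variable {n : ℕ}

/-- The coordinate vector `∂/∂x^i`. -/
def ex (i : Fin n) : Pt n := (Pi.single i 1, 0)

/-- The coordinate vector `∂/∂y^i`. -/
def ey (i : Fin n) : Pt n := (0, Pi.single i 1)

/-- Partial derivative of a scalar function in the constant direction `v`. -/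
def pd (v : Pt n) (f : Pt n → ℝ) (p : Pt n) : ℝ := fderiv ℝ f p v

/-- Derivative of a scalar function along a vector field. -/
def Dv (X : VF n) (f : Pt n → ℝ) (p : Pt n) : ℝ := fderiv ℝ f p (X p)

/-- The Lie bracket of two vector fields, in coordinates. -/
def lie (X Y : VF n) : VF n := fun p => fderiv ℝ Y p (X p) - fderiv ℝ X p (Y p)

/-- Local-coordinate data of an `n`-dimensional Finsler manifold `(M, F)` on a
chart domain `U ⊆ TM` avoiding the zero section: the fundamental function `F`
(smooth, positive and positively `1`-homogeneous in `y`), the fundamental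
tensor `g_{ij} = ½ ∂²F²/∂y^i∂y^j` (symmetric and positive definite) with its
inverse `g^{ij}`, the spray coefficients
`G^i = (g^{ij}/4)(∂²F²/∂y^j∂x^k y^k − ∂F²/∂x^j)` and the nonlinear connection
coefficients `G_i^j = ∂G^j/∂y^i`. -/
structure Chart (n : ℕ) : Type where
  /-- the chart domain in `TM` -/
  U : Set (Pt n)
  hUopen : IsOpen U
  hUslit : ∀ p ∈ U, p.2 ≠ 0
  /-- the fundamental function `F` -/
  F : Pt n → ℝ
  Fpos : ∀ p ∈ U, 0 < F p
  Fsmooth : ContDiffOn ℝ (⊤ : ℕ∞) F U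
  Fhomog : ∀ p ∈ U, ∀ t : ℝ, 0 < t → (p.1, t • p.2) ∈ U →
    F (p.1, t • p.2) = t * F p
  /-- the fundamental tensor `g_{ij}` -/
  g : Fin n → Fin n → Pt n → ℝ
  gdef : ∀ i j, ∀ p ∈ U,
    g i j p = (1/2) * pd (ey i) (pd (ey j) (fun q => F q ^ 2)) p
  gsmooth : ∀ i j, ContDiffOn ℝ (⊤ : ℕ∞) (g i j) U
  gsymm : ∀ i j, ∀ p ∈ U, g i j p = g j i p
  gposdef : ∀ p ∈ U, ∀ v : Fin n → ℝ, v ≠ 0 →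
    0 < ∑ i, ∑ j, g i j p * v i * v j
  /-- the inverse `g^{ij}` of the fundamental tensor -/
  ginv : Fin n → Fin n → Pt n → ℝ
  hginv : ∀ i j, ∀ p ∈ U,
    (∑ k, g i k p * ginv k j p) = if i = j then (1:ℝ) else 0
  /-- the spray coefficients `G^i` -/
  spray : Fin n → Pt n → ℝ
  spraydef : ∀ i, ∀ p ∈ U, spray i p = (1/4) * ∑ j, ginv i j p *
      ((∑ k, pd (ey j) (pd (ex k) (fun q => F q ^ 2)) p * p.2 k)
        - pd (ex j) (fun q => F q ^ 2) p)
  /-- the nonlinear connection coefficients `G_i^j` -/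
  N : Fin n → Fin n → Pt n → ℝ
  Ndef : ∀ i j, ∀ p ∈ U, N i j p = pd (ey i) (spray j) p
  Nsmooth : ∀ i j, ContDiffOn ℝ (⊤ : ℕ∞) (N i j) U

variable (fc : Chart n)

/-- the vertical frame field `∂/∂y^i`. -/
def dyv (i : Fin n) : VF n := fun _ => ey i

/-- the horizontal frame field `δ/δx^i = ∂/∂x^i − G_i^j ∂/∂y^j`. -/
def ddx (i : Fin n) : VF n := fun p => (Pi.single i 1, fun j => -(fc.N i j p))

/-- the vertical Liouville vector field `L = y^i ∂/∂y^i`. -/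
def LV : VF n := fun p => ((0 : Fin n → ℝ), p.2)

/-- the horizontal Liouville vector field `ξ = y^i δ/δx^i`. -/
def XI : VF n := fun p => (p.2, fun j => -(∑ i, p.2 i * fc.N i j p))

/-- the dual coframe `δy^i = dy^i + G_j^i dx^j`, applied to a tangent vector. -/
def dely (i : Fin n) (p : Pt n) (v : Pt n) : ℝ := v.2 i + ∑ j, fc.N j i p * v.1 j

/-- the Sasaki lifted metric `G = g_{ij} dx^i ⊗ dx^j + g_{ij} δy^i ⊗ δy^j`. -/
def Gs (p : Pt n) (v w : Pt n) : ℝ :=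
  ∑ i, ∑ j, fc.g i j p * (v.1 i * w.1 j + dely fc i p v * dely fc j p w)

/-- the natural almost complex structure
`J = δ/δx^i ⊗ δy^i − ∂/∂y^i ⊗ dx^i`, as a pointwise endomorphism. -/
def Jm (p : Pt n) (v : Pt n) : Pt n :=
  (fun i => dely fc i p v,
   fun k => -(∑ i, dely fc i p v * fc.N i k p) - v.1 k)

/-- `J` applied to a vector field. -/
def Jvf (X : VF n) : VF n := fun p => Jm fc p (X p)

/-- the curvature coefficients `R^k_{ij} = δG_i^k/δx^j − δG_j^k/δx^i` of the
nonlinear connection. -/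
def Rc (i j k : Fin n) (p : Pt n) : ℝ :=
  Dv (ddx fc j) (fc.N i k) p - Dv (ddx fc i) (fc.N j k) p

/-- the Cartan tensor `g_{ijk} = ½ ∂g_{ij}/∂y^k`. -/
def Cartan (i j k : Fin n) (p : Pt n) : ℝ := (1/2) * pd (ey k) (fc.g i j) p

/-- the vertical adapted frame field `∂̄/∂̄y^a = E_a^i ∂/∂y^i`. -/
def vb (E : Fin (n-1) → Fin n → Pt n → ℝ) (a : Fin (n-1)) : VF n :=
  fun p => ((0 : Fin n → ℝ), fun i => E a i p)

/-- the horizontal adapted frame field `δ̄/δ̄x^a = J(∂̄/∂̄y^a)`. -/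
def hb (E : Fin (n-1) → Fin n → Pt n → ℝ) (a : Fin (n-1)) : VF n :=
  fun p => Jm fc p (vb E a p)

/-- `E` is the coefficient matrix of an adapted local frame
`∂̄/∂̄y^a = E_a^i ∂/∂y^i`, `a = 1, …, n−1`, of the distribution `V'TM` (the
`G`-orthogonal complement of the vertical Liouville field `L` inside the
vertical distribution `VTM`): the coefficients are smooth, pointwise linearly
independent, and each `∂̄/∂̄y^a` is `G`-orthogonal to `L`. -/
def IsAdaptedFrame (E : Fin (n-1) → Fin n → Pt n → ℝ) : Prop :=
  (∀ a i, ContDiffOn ℝ (⊤ : ℕ∞) (E a i) fc.U) ∧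
  (∀ p ∈ fc.U, LinearIndependent ℝ (fun a : Fin (n-1) => (fun i => E a i p))) ∧
  (∀ a, ∀ p ∈ fc.U, Gs fc p (vb E a p) (LV p) = 0)

/-- `g_{ab} = g_{ij} E_a^i E_b^j`, the components of the Sasaki metric in the
adapted frame. -/
def gb (E : Fin (n-1) → Fin n → Pt n → ℝ) (p : Pt n) (a b : Fin (n-1)) : ℝ :=
  ∑ i, ∑ j, fc.g i j p * E a i p * E b j p

/-- the matrix `(g_{ab})`. -/
def gbMat (E : Fin (n-1) → Fin n → Pt n → ℝ) (p : Pt n) :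
    Matrix (Fin (n-1)) (Fin (n-1)) ℝ :=
  Matrix.of fun a b => gb fc E p a b

/-- `(g^{ab})`, the inverse of the matrix `(g_{ab})`. -/
def gbInv (E : Fin (n-1) → Fin n → Pt n → ℝ) (p : Pt n) (a b : Fin (n-1)) : ℝ :=
  (gbMat fc E p)⁻¹ a b

/-- `g_{abc} = ½ E_a^i E_b^j E_c^k g_{ijk}`, the Cartan tensor in the adapted
frame. -/
def CartanBar (E : Fin (n-1) → Fin n → Pt n → ℝ) (a b c : Fin (n-1))
    (p : Pt n) : ℝ :=
  (1/2) * ∑ i, ∑ j, ∑ k, E a i p * E b j p * E c k p * Cartan fc i j k p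

/-- `R_{cab} = E_c^i E_a^j E_b^k R^h_{jk} g_{hi}`, the lowered curvature of the
nonlinear connection in the adapted frame. -/
def Rlow (E : Fin (n-1) → Fin n → Pt n → ℝ) (c a b : Fin (n-1)) (p : Pt n) : ℝ :=
  ∑ i, ∑ j, ∑ k, ∑ h, E c i p * E a j p * E b k p * Rc fc j k h p * fc.g h i p

/-- `nab` is the Levi-Civita connection of the Sasaki metric `G` on the chart
domain, characterized by the Koszul formula
`2G(∇_X Y, Z) = X G(Y,Z) + Y G(X,Z) − Z G(X,Y)
  − G([X,Z],Y) − G([Y,Z],X) + G([X,Y],Z)`. -/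
def IsLeviCivita (nab : VF n → VF n → VF n) : Prop :=
  ∀ X Y Z : VF n,
    ContDiffOn ℝ (⊤ : ℕ∞) X fc.U → ContDiffOn ℝ (⊤ : ℕ∞) Y fc.U →
    ContDiffOn ℝ (⊤ : ℕ∞) Z fc.U → ∀ p ∈ fc.U,
    2 * Gs fc p (nab X Y p) (Z p) =
      Dv X (fun q => Gs fc q (Y q) (Z q)) p
      + Dv Y (fun q => Gs fc q (X q) (Z q)) p
      - Dv Z (fun q => Gs fc q (X q) (Y q)) p
      - Gs fc p (lie X Z p) (Y p)
      - Gs fc p (lie Y Z p) (X p)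
      + Gs fc p (lie X Y p) (Z p)

/-- the `G`-orthogonal projection of a vector field onto the line spanned by
the vertical Liouville field `L` (the normal direction to the indicatrix). -/
def projL (X : VF n) : VF n :=
  fun p => (Gs fc p (X p) (LV p) / Gs fc p (LV p) (LV p)) • LV p

/-- the curvature tensor `R(X,Y)Z = ∇_X ∇_Y Z − ∇_Y ∇_X Z − ∇_{[X,Y]} Z` of a
connection. -/
def curv (nab : VF n → VF n → VF n) (X Y Z : VF n) : VF n :=
  fun p => nab X (nab Y Z) p - nab Y (nab X Z) p - nab (lie X Y) Z p

/-- membership in `V'TM`: vertical and `G`-orthogonal to `L`. -/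
def InV' (p v : Pt n) : Prop := v.1 = 0 ∧ Gs fc p v (LV p) = 0

/-- membership in `V^⊥TM`: `G`-orthogonal to `L`. -/
def InVperp (p v : Pt n) : Prop := Gs fc p v (LV p) = 0

/-- membership in `HTM ⊕ ⟨L⟩`, the `G`-orthogonal complement of `V'TM`. -/
def InHL (p v : Pt n) : Prop := ∃ c : ℝ, ∀ i, dely fc i p v = c * p.2 i

/-- membership in the line spanned by the vertical Liouville field `L`. -/
def InL (p v : Pt n) : Prop := ∃ c : ℝ, v = c • LV p

/-- membership in the plane spanned by `L` and `ξ`. -/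
def InLXi (p v : Pt n) : Prop := ∃ c d : ℝ, v = c • LV p + d • XI fc p

/-- membership in the `G`-orthogonal complement of `⟨L, ξ⟩`. -/
def InLXiPerp (p v : Pt n) : Prop :=
  Gs fc p v (LV p) = 0 ∧ Gs fc p v (XI fc p) = 0

/-- the contact `1`-form `η = y^i g_{ij} dx^j` of the indicatrix bundle,
applied to a tangent vector. -/
def etaC (p : Pt n) (v : Pt n) : ℝ := ∑ i, ∑ j, p.2 i * fc.g i j p * v.1 j

/-- the `(1,1)`-tensor `φ` of the contact structure of the indicatrix bundle:
`φ = J` on the contact distribution `D` and `φ(ξ) = 0`; on tangent vectors of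
`IM` it is given by `φ(v) = J v + η(v) L`. -/
def phiC (p : Pt n) (v : Pt n) : Pt n := Jm fc p v + etaC fc p v • LV p

/-- `φ` applied to a vector field. -/
def phiVF (X : VF n) : VF n := fun p => phiC fc p (X p)

/-- `η` applied to a vector field, as a scalar function. -/
def etaVF (X : VF n) : Pt n → ℝ := fun p => etaC fc p (X p)

/-- the exterior derivative `dη(X,Y) = X(η(Y)) − Y(η(X)) − η([X,Y])`. -/
def dEta (X Y : VF n) (p : Pt n) : ℝ :=
  Dv X (etaVF fc Y) p - Dv Y (etaVF fc X) p - etaC fc p (lie X Y p)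

/-- the normality tensor `N^{(1)} = [φ,φ] + 2 dη ⊗ ξ` of the contact structure
of the indicatrix bundle, evaluated on vector fields, where
`[φ,φ](X,Y) = φ²[X,Y] + [φX,φY] − φ[φX,Y] − φ[X,φY]` is the Nijenhuis torsion
of `φ`. -/
def Ntensor (X Y : VF n) : VF n := fun p =>
  phiC fc p (phiC fc p (lie X Y p)) + lie (phiVF fc X) (phiVF fc Y) p
    - phiC fc p (lie (phiVF fc X) Y p) - phiC fc p (lie X (phiVF fc Y) p)
    + (2 * dEta fc X Y p) • XI fc p

/-- a vector field of `TM` is tangent to the indicatrix bundle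
`IM = {F = 1}` (equivalently, `G`-orthogonal to the normal field `L` along
`IM`). -/
def TangentIM (X : VF n) : Prop :=
  ∀ p ∈ fc.U, fc.F p = 1 → Gs fc p (X p) (LV p) = 0

/-- The indicatrix bundle `IM`, with its natural contact metric structure
`(φ, η, ξ, Ḡ)`, is a Sasakian manifold: the contact structure is normal, i.e.
the tensor `N^{(1)} = [φ,φ] + 2 dη ⊗ ξ` vanishes on vector fields tangent to
`IM`. -/
def IsSasakianIM : Prop :=
  ∀ X Y : VF n, ContDiffOn ℝ (⊤ : ℕ∞) X fc.U → ContDiffOn ℝ (⊤ : ℕ∞) Y fc.U →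
    TangentIM fc X → TangentIM fc Y →
    ∀ p ∈ fc.U, fc.F p = 1 → Ntensor fc X Y p = 0

/-- the Nijenhuis tensor of the natural almost complex structure `J`:
`N_J(X,Y) = [JX,JY] − J[JX,Y] − J[X,JY] + J²[X,Y]`, with `J² = −Id`. -/
def NijJ (X Y : VF n) : VF n := fun p =>
  lie (Jvf fc X) (Jvf fc Y) p - Jm fc p (lie (Jvf fc X) Y p)
    - Jm fc p (lie X (Jvf fc Y) p) - lie X Y p

/-- the almost complex structure `J̄` on `TM ≅ IM × ℝ` induced by the contact
structure `(φ, η, ξ)` of the indicatrix bundle via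
`J̄(X + f L) = φ(X) − f ξ + η(X) L`, where `X` is tangent to `IM`;
a tangent vector `v` is decomposed as `v = vᵀ + f L` with
`f = G(v,L)/G(L,L)` and `vᵀ` tangent to the indicatrix. -/
def Jbar (p : Pt n) (v : Pt n) : Pt n :=
  phiC fc p (v - (Gs fc p v (LV p) / Gs fc p (LV p) (LV p)) • LV p)
    - (Gs fc p v (LV p) / Gs fc p (LV p) (LV p)) • XI fc p
    + etaC fc p (v - (Gs fc p v (LV p) / Gs fc p (LV p) (LV p)) • LV p) • LV p


section Calculus

lemma contDiffOn_pd {U : Set (Pt n)} (hU : IsOpen U) {f : Pt n → ℝ}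
    (hf : ContDiffOn ℝ (⊤ : ℕ∞) f U) (v : Pt n) :
    ContDiffOn ℝ (⊤ : ℕ∞) (pd v f) U :=
  (hf.fderiv_of_isOpen hU (m := ((⊤ : ℕ∞) : WithTop ℕ∞)) (by simp)).clm_apply contDiffOn_const

lemma differentiableAt_of_contDiffOn {V : Type*} [NormedAddCommGroup V] [NormedSpace ℝ V]
    {U : Set (Pt n)} (hU : IsOpen U) {f : Pt n → V} (hf : ContDiffOn ℝ (⊤ : ℕ∞) f U)
    {p : Pt n} (hp : p ∈ U) : DifferentiableAt ℝ f p :=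
  (hf.contDiffAt (hU.mem_nhds hp)).differentiableAt (by simp)

lemma pd_congr {U : Set (Pt n)} (hU : IsOpen U) {f h : Pt n → ℝ}
    (hfh : ∀ q ∈ U, f q = h q) (v : Pt n) {p : Pt n} (hp : p ∈ U) : pd v f p = pd v h p := by
  have : f =ᶠ[nhds p] h := Filter.eventually_of_mem (hU.mem_nhds hp) hfh
  rw [pd, pd, this.fderiv_eq]

lemma pd_sum_mul {f h : Fin n → Pt n → ℝ} {p : Pt n} (hf : ∀ j, DifferentiableAt ℝ (f j) p)
    (hh : ∀ j, DifferentiableAt ℝ (h j) p) (v : Pt n) :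
    pd v (fun q => ∑ j, f j q * h j q) p
      = ∑ j, (pd v (f j) p * h j p + f j p * pd v (h j) p) := by
  unfold pd
  rw [fderiv_fun_sum fun j _ => (hf j).fun_mul (hh j), sum_apply]
  refine Finset.sum_congr rfl fun j _ => ?_
  rw [fderiv_fun_mul (hf j) (hh j)]
  simp only [add_apply, smul_apply, smul_eq_mul]
  ring

lemma pd_sub {f h : Pt n → ℝ} {p : Pt n} (hf : DifferentiableAt ℝ f p)
    (hh : DifferentiableAt ℝ h p) (v : Pt n) :
    pd v (fun q => f q - h q) p = pd v f p - pd v h p := by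
  unfold pd
  rw [fderiv_fun_sub hf hh, sub_apply]

lemma pd_const_mul {h : Pt n → ℝ} {p : Pt n}
    (hh : DifferentiableAt ℝ h p) (c : ℝ) (v : Pt n) :
    pd v (fun q => c * h q) p = c * pd v h p := by
  unfold pd
  rw [fderiv_const_mul hh, smul_apply, smul_eq_mul]

lemma hasFDerivAt_base (i : Fin n) (p : Pt n) : HasFDerivAt (fun q : Pt n => q.1 i)
    ((ContinuousLinearMap.proj i).comp (ContinuousLinearMap.fst ℝ (Fin n → ℝ) (Fin n → ℝ))) p :=
  ((ContinuousLinearMap.proj (R := ℝ) (φ := fun _ : Fin n => ℝ) i).comp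
    (ContinuousLinearMap.fst ℝ (Fin n → ℝ) (Fin n → ℝ))).hasFDerivAt

lemma hasFDerivAt_fibre (i : Fin n) (p : Pt n) : HasFDerivAt (fun q : Pt n => q.2 i)
    ((ContinuousLinearMap.proj i).comp (ContinuousLinearMap.snd ℝ (Fin n → ℝ) (Fin n → ℝ))) p :=
  ((ContinuousLinearMap.proj (R := ℝ) (φ := fun _ : Fin n => ℝ) i).comp
    (ContinuousLinearMap.snd ℝ (Fin n → ℝ) (Fin n → ℝ))).hasFDerivAt

lemma pd_fibre (i : Fin n) (v p : Pt n) : pd v (fun q : Pt n => q.2 i) p = v.2 i := by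
  rw [pd, (hasFDerivAt_fibre i p).fderiv]; rfl

lemma contDiff_fibre (i : Fin n) : ContDiff ℝ (⊤ : ℕ∞) (fun q : Pt n => q.2 i) := by fun_prop

lemma pd_eq_sum (f : Pt n → ℝ) (p v : Pt n) :
    pd v f p = ∑ i, v.1 i * pd (ex i) f p + ∑ i, v.2 i * pd (ey i) f p := by
  have hv : v = ∑ i, v.1 i • ex i + ∑ i, v.2 i • ey i := by
    refine Prod.ext ?_ ?_ <;> ext j <;>
      simp [ex, ey, Prod.fst_sum, Prod.snd_sum, Finset.sum_apply, Pi.single_apply]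
  unfold pd
  conv_lhs => rw [hv]
  simp only [map_add, map_sum, map_smul, smul_eq_mul]

lemma pd_LV (f : Pt n → ℝ) (p : Pt n) :
    pd (LV p) f p = ∑ i, p.2 i * pd (ey i) f p := by
  rw [pd_eq_sum]; simp [LV]

/-- The derivative of `Y f` in the direction `w`. -/
lemma pd_Dv {U : Set (Pt n)} (hU : IsOpen U) {f : Pt n → ℝ} (hf : ContDiffOn ℝ (⊤ : ℕ∞) f U)
    {Y : VF n} {p : Pt n} (hp : p ∈ U) (hY : DifferentiableAt ℝ Y p) (w : Pt n) :
    pd w (Dv Y f) p = fderiv ℝ (fderiv ℝ f) p w (Y p) + fderiv ℝ f p (fderiv ℝ Y p w) := by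
  have h1 : DifferentiableAt ℝ (fderiv ℝ f) p := differentiableAt_of_contDiffOn hU
    (hf.fderiv_of_isOpen hU (m := ((⊤ : ℕ∞) : WithTop ℕ∞)) (by simp)) hp
  have h2 := (h1.hasFDerivAt.clm_apply hY.hasFDerivAt).fderiv
  unfold pd Dv
  rw [h2]
  simp [add_comm]

lemma snd_fderiv_symm {U : Set (Pt n)} (hU : IsOpen U) {f : Pt n → ℝ}
    (hf : ContDiffOn ℝ (⊤ : ℕ∞) f U) {p : Pt n} (hp : p ∈ U) (v w : Pt n) :
    fderiv ℝ (fderiv ℝ f) p v w = fderiv ℝ (fderiv ℝ f) p w v :=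
  ((hf.contDiffAt (hU.mem_nhds hp)).isSymmSndFDerivAt (by
    rw [minSmoothness_of_isRCLikeNormedField]; exact WithTop.coe_le_coe.2 le_top)) v w

/-- If `f` is constant along `X` and `Y`, it is constant along `[X, Y]`. -/
lemma fderiv_lie_eq_zero {U : Set (Pt n)} (hU : IsOpen U) {f : Pt n → ℝ}
    (hf : ContDiffOn ℝ (⊤ : ℕ∞) f U) {X Y : VF n} (hX : ContDiffOn ℝ (⊤ : ℕ∞) X U)
    (hY : ContDiffOn ℝ (⊤ : ℕ∞) Y U) (hXf : ∀ q ∈ U, Dv X f q = 0) (hYf : ∀ q ∈ U, Dv Y f q = 0)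
    {p : Pt n} (hp : p ∈ U) : pd (lie X Y p) f p = 0 := by
  have hconst (w : Pt n) : pd w (fun _ : Pt n => (0 : ℝ)) p = 0 := by simp [pd]
  have h1 := pd_Dv hU hf hp (differentiableAt_of_contDiffOn hU hX hp) (Y p)
  have h2 := pd_Dv hU hf hp (differentiableAt_of_contDiffOn hU hY hp) (X p)
  rw [pd_congr hU hXf _ hp, hconst] at h1
  rw [pd_congr hU hYf _ hp, hconst] at h2
  have h3 := snd_fderiv_symm hU hf hp (X p) (Y p)
  simp only [pd, lie, map_sub]
  linarith

lemma fderiv_LV (p v : Pt n) : fderiv ℝ (LV : VF n) p v = (0, v.2) := by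
  have : (LV : VF n) = (0 : Pt n →L[ℝ] (Fin n → ℝ)).prod
    (ContinuousLinearMap.snd ℝ (Fin n → ℝ) (Fin n → ℝ)) := rfl
  rw [this, ContinuousLinearMap.fderiv]
  rfl

lemma contDiff_LV : ContDiff ℝ (⊤ : ℕ∞) (LV : VF n) := by
  unfold LV; fun_prop

/-- `f` is infinitesimally homogeneous of degree `k` in the fibre variable on `U`. -/
def EulerHom (U : Set (Pt n)) (k : ℝ) (f : Pt n → ℝ) : Prop :=
  ∀ p ∈ U, pd (LV p) f p = k * f p

/-- The derivative of a `k`-homogeneous function in a direction `v` scaled by `c` under the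
linearized fibre dilation is homogeneous of degree `k - c`. -/
lemma EulerHom.pd_of_smul {U : Set (Pt n)} (hU : IsOpen U) {f : Pt n → ℝ}
    (hf : ContDiffOn ℝ (⊤ : ℕ∞) f U) {k c : ℝ} (h : EulerHom U k f) {v : Pt n}
    (hv : ((0 : Fin n → ℝ), v.2) = c • v) : EulerHom U (k - c) (pd v f) := by
  intro p hp
  have h1 := pd_Dv hU hf hp (contDiff_LV.contDiffAt.differentiableAt (by simp)) v
  have h2 := pd_Dv hU hf hp (differentiableAt_const v) (LV p)
  have h3 : pd v (Dv LV f) p = k * pd v f p := by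
    exact (pd_congr hU (h := fun q => k * f q) h v hp).trans
      (pd_const_mul (differentiableAt_of_contDiffOn hU hf hp) k v)
  rw [h3, fderiv_LV, hv, map_smul, smul_eq_mul] at h1
  rw [fderiv_fun_const, snd_fderiv_symm hU hf hp] at h2
  change pd (LV p) (Dv (fun _ => v) f) p = _
  rw [h2]
  simp only [pd] at h1 ⊢
  simp only [Pi.zero_apply, zero_apply, map_zero]
  linarith

lemma EulerHom.pd_ex {U : Set (Pt n)} (hU : IsOpen U) {f : Pt n → ℝ}
    (hf : ContDiffOn ℝ (⊤ : ℕ∞) f U) {k : ℝ} (h : EulerHom U k f) (i : Fin n) :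
    EulerHom U k (pd (ex i) f) := by
  have := h.pd_of_smul hU hf (c := 0) (v := ex i) (by simp [ex])
  rwa [sub_zero] at this

lemma EulerHom.pd_ey {U : Set (Pt n)} (hU : IsOpen U) {f : Pt n → ℝ}
    (hf : ContDiffOn ℝ (⊤ : ℕ∞) f U) {k : ℝ} (h : EulerHom U k f) (i : Fin n) :
    EulerHom U (k - 1) (pd (ey i) f) :=
  h.pd_of_smul hU hf (by simp [ey])

end Calculus

section Finsler

variable {fc}

lemma contDiffOn_sq_F : ContDiffOn ℝ (⊤ : ℕ∞) (fun q => fc.F q ^ 2) fc.U := fc.Fsmooth.pow 2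

lemma eulerHom_F : EulerHom fc.U 1 fc.F := by
  intro p hp
  let c : ℝ → Pt n := fun t => (p.1, t • p.2)
  have hc : HasDerivAt c (LV p) 1 := by
    refine HasDerivAt.prodMk (hasDerivAt_const _ _) ?_
    simpa using (hasDerivAt_id (1 : ℝ)).smul_const p.2
  have hc1 : c 1 = p := by simp [c]
  have hF : HasFDerivAt fc.F (fderiv ℝ fc.F p) (c 1) := by
    rw [hc1]; exact (differentiableAt_of_contDiffOn fc.hUopen fc.Fsmooth hp).hasFDerivAt
  have h1 := hF.comp_hasDerivAt 1 hc
  have h2 : HasDerivAt (fun t : ℝ => t * fc.F p) (1 * fc.F p) 1 :=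
    (hasDerivAt_id (1 : ℝ)).mul_const _
  have hev : (fc.F ∘ c) =ᶠ[nhds 1] fun t : ℝ => t * fc.F p := by
    have hU : ∀ᶠ t in nhds (1 : ℝ), c t ∈ fc.U :=
      hc.continuousAt.eventually_mem (by rw [hc1]; exact fc.hUopen.mem_nhds hp)
    filter_upwards [hU, lt_mem_nhds (zero_lt_one' ℝ)] with t ht h0
    exact fc.Fhomog p hp t h0 ht
  exact h1.unique (h2.congr_of_eventuallyEq hev)

lemma eulerHom_sq_F : EulerHom fc.U 2 (fun q => fc.F q ^ 2) := by
  intro p hp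
  have h := eulerHom_F p hp
  unfold pd at *
  rw [fderiv_fun_pow 2 (differentiableAt_of_contDiffOn fc.hUopen fc.Fsmooth hp)]
  simp only [smul_apply, h, smul_eq_mul]
  simp; ring

lemma eulerHom_g (i j : Fin n) : EulerHom fc.U 0 (fc.g i j) := by
  intro p hp
  have hs := contDiffOn_pd fc.hUopen (contDiffOn_sq_F (fc := fc)) (ey j)
  have h := ((eulerHom_sq_F.pd_ey fc.hUopen contDiffOn_sq_F j).pd_ey fc.hUopen hs i) p hp
  rw [pd_congr fc.hUopen (fc.gdef i j) _ hp, pd_const_mul (differentiableAt_of_contDiffOn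
    fc.hUopen (contDiffOn_pd fc.hUopen hs _) hp), h]
  ring

/-- `g_{ij} y^i = ½ ∂F²/∂y^j`. -/
lemma sum_g_fibre (j : Fin n) {p : Pt n} (hp : p ∈ fc.U) :
    ∑ i, p.2 i * fc.g i j p = (1/2) * pd (ey j) (fun q => fc.F q ^ 2) p := by
  have h := eulerHom_sq_F.pd_ey fc.hUopen contDiffOn_sq_F j p hp
  rw [pd_LV] at h
  have : ∑ i, p.2 i * fc.g i j p
      = (1/2) * ∑ i, p.2 i * pd (ey i) (pd (ey j) (fun q => fc.F q ^ 2)) p := by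
    rw [Finset.mul_sum]
    exact Finset.sum_congr rfl fun i _ => by rw [fc.gdef i j p hp]; ring
  rw [this, h]; ring

lemma contDiffOn_det {m : ℕ} {U : Set (Pt n)} {A : Pt n → Matrix (Fin m) (Fin m) ℝ}
    (hA : ∀ i j, ContDiffOn ℝ (⊤ : ℕ∞) (fun p => A p i j) U) :
    ContDiffOn ℝ (⊤ : ℕ∞) (fun p => (A p).det) U := by
  simp only [Matrix.det_apply]
  refine ContDiffOn.sum fun σ _ => ContDiffOn.const_smul _ ?_
  exact contDiffOn_prod fun i _ => hA _ _

lemma contDiffOn_ginv (i j : Fin n) : ContDiffOn ℝ (⊤ : ℕ∞) (fc.ginv i j) fc.U := by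
  let A : Pt n → Matrix (Fin n) (Fin n) ℝ := fun p => Matrix.of fun i j => fc.g i j p
  have hmul : ∀ p ∈ fc.U, A p * (Matrix.of fun i j => fc.ginv i j p) = 1 := by
    intro p hp
    ext i j
    rw [Matrix.mul_apply, Matrix.one_apply]
    exact fc.hginv i j p hp
  have hdet : ∀ p ∈ fc.U, (A p).det ≠ 0 := fun p hp =>
    left_ne_zero_of_mul_eq_one (by rw [← Matrix.det_mul, hmul p hp, Matrix.det_one])
  have hA : ∀ i j, ContDiffOn ℝ (⊤ : ℕ∞) (fun p => A p i j) fc.U := fc.gsmooth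
  have hadj : ContDiffOn ℝ (⊤ : ℕ∞) (fun p => (A p).adjugate i j) fc.U := by
    simp only [Matrix.adjugate_apply]
    refine contDiffOn_det fun k l => ?_
    by_cases hk : k = j
    · subst hk; simpa using contDiffOn_const
    · simpa [Matrix.updateRow_ne hk] using hA k l
  refine (((contDiffOn_det hA).inv hdet).mul hadj).congr fun p hp => ?_
  have h := Matrix.inv_eq_right_inv (hmul p hp)
  have h2 : (A p)⁻¹ i j = fc.ginv i j p := by rw [h]; rfl
  rw [← h2, Matrix.inv_def]
  simp

/-- The right-hand side `∂²F²/∂y^i∂x^k y^k − ∂F²/∂x^i` of the lowered spray equation. -/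
def loweredSpray (fc : Chart n) (i : Fin n) (p : Pt n) : ℝ :=
  (∑ k, pd (ey i) (pd (ex k) (fun q => fc.F q ^ 2)) p * p.2 k) - pd (ex i) (fun q => fc.F q ^ 2) p

lemma contDiffOn_loweredSpray (i : Fin n) :
    ContDiffOn ℝ (⊤ : ℕ∞) (loweredSpray fc i) fc.U := by
  have h (v : Pt n) := contDiffOn_pd fc.hUopen (contDiffOn_sq_F (fc := fc)) v
  exact (ContDiffOn.sum fun k _ => (contDiffOn_pd fc.hUopen (h _) _).mul
    (contDiff_fibre k).contDiffOn).sub (h _)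

lemma contDiffOn_spray (i : Fin n) : ContDiffOn ℝ (⊤ : ℕ∞) (fc.spray i) fc.U :=
  (contDiffOn_const.mul (ContDiffOn.sum fun j _ =>
    (contDiffOn_ginv i j).mul (contDiffOn_loweredSpray j))).congr (fc.spraydef i)

lemma sum_g_spray (i : Fin n) {p : Pt n} (hp : p ∈ fc.U) :
    ∑ j, fc.g i j p * fc.spray j p = (1/4) * loweredSpray fc i p := by
  have h : ∀ j, fc.g i j p * fc.spray j p
      = ∑ k, (1/4) * (fc.g i j p * fc.ginv j k p * loweredSpray fc k p) := by
    intro j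
    rw [fc.spraydef j p hp, Finset.mul_sum, Finset.mul_sum]
    exact Finset.sum_congr rfl fun k _ => by unfold loweredSpray; ring
  simp_rw [h]
  rw [Finset.sum_comm]
  simp_rw [← Finset.mul_sum, ← Finset.sum_mul, fc.hginv i _ p hp]
  simp

lemma eulerHom_loweredSpray (i : Fin n) : EulerHom fc.U 2 (loweredSpray fc i) := by
  intro p hp
  have hs (v : Pt n) := contDiffOn_pd fc.hUopen (contDiffOn_sq_F (fc := fc)) v
  have hx (k : Fin n) := eulerHom_sq_F.pd_ex fc.hUopen (contDiffOn_sq_F (fc := fc)) k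
  have hyx (k : Fin n) := (hx k).pd_ey fc.hUopen (hs _) i
  have hd (k : Fin n) := differentiableAt_of_contDiffOn fc.hUopen
    (contDiffOn_pd fc.hUopen (hs (ex k)) (ey i)) hp
  have hyd (k : Fin n) : DifferentiableAt ℝ (fun q : Pt n => q.2 k) p :=
    (hasFDerivAt_fibre k p).differentiableAt
  unfold loweredSpray
  rw [pd_sub (DifferentiableAt.fun_sum fun k _ => (hd k).fun_mul (hyd k))
    (differentiableAt_of_contDiffOn fc.hUopen (hs _) hp), pd_sum_mul hd hyd, hx i p hp,
    mul_sub, Finset.mul_sum]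
  congr 1
  refine Finset.sum_congr rfl fun k _ => ?_
  rw [hyx k p hp, pd_fibre]
  simp only [LV]
  ring

lemma eq_zero_of_sum_g_eq_zero {p : Pt n} (hp : p ∈ fc.U) {v : Fin n → ℝ}
    (hv : ∀ i, ∑ j, fc.g i j p * v j = 0) : v = 0 := by
  by_contra hne
  have h := fc.gposdef p hp v hne
  have : ∑ i, ∑ j, fc.g i j p * v i * v j = 0 := by
    refine Finset.sum_eq_zero fun i _ => ?_
    rw [← mul_zero (v i), ← hv i, Finset.mul_sum]
    exact Finset.sum_congr rfl fun j _ => by ring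
  exact h.ne' this

lemma eulerHom_spray (i : Fin n) : EulerHom fc.U 2 (fc.spray i) := by
  intro p hp
  have hG (j : Fin n) := differentiableAt_of_contDiffOn fc.hUopen (contDiffOn_spray (fc := fc) j) hp
  have hz := eq_zero_of_sum_g_eq_zero hp
    (v := fun j => pd (LV p) (fc.spray j) p - 2 * fc.spray j p) fun k => by
      have hg (j : Fin n) := differentiableAt_of_contDiffOn fc.hUopen (fc.gsmooth k j) hp
      have h1 := pd_congr fc.hUopen (fun q hq => sum_g_spray k hq) (LV p) hp
      rw [pd_const_mul (differentiableAt_of_contDiffOn fc.hUopen (contDiffOn_loweredSpray k) hp),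
        eulerHom_loweredSpray k p hp, pd_sum_mul hg hG] at h1
      simp only [eulerHom_g k _ p hp, zero_mul, zero_add] at h1
      have h2 := sum_g_spray k hp
      have h3 : ∑ j, fc.g k j p * (pd (LV p) (fc.spray j) p - 2 * fc.spray j p)
          = ∑ j, fc.g k j p * pd (LV p) (fc.spray j) p
            - 2 * ∑ j, fc.g k j p * fc.spray j p := by
        rw [Finset.mul_sum, ← Finset.sum_sub_distrib]
        exact Finset.sum_congr rfl fun j _ => by ring
      linarith
  have := congrFun hz i
  simp only [Pi.zero_apply] at this
  linarith

lemma eulerHom_N (i j : Fin n) : EulerHom fc.U 1 (fc.N i j) := by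
  intro p hp
  rw [pd_congr fc.hUopen (fc.Ndef i j) _ hp, fc.Ndef i j p hp,
    (eulerHom_spray j).pd_ey fc.hUopen (contDiffOn_spray j) i p hp]
  ring

/-- `δF²/δx^i = 0`. -/
lemma pd_ex_sq_F (i : Fin n) {p : Pt n} (hp : p ∈ fc.U) :
    pd (ex i) (fun q => fc.F q ^ 2) p
      = ∑ j, fc.N i j p * pd (ey j) (fun q => fc.F q ^ 2) p := by
  set e : Pt n → ℝ := fun q => fc.F q ^ 2 with he
  have hs (v : Pt n) : ContDiffOn ℝ (⊤ : ℕ∞) (pd v e) fc.U :=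
    contDiffOn_pd fc.hUopen contDiffOn_sq_F v
  have hd (v : Pt n) : DifferentiableAt ℝ (pd v e) p :=
    differentiableAt_of_contDiffOn fc.hUopen (hs v) hp
  have hG (j : Fin n) := differentiableAt_of_contDiffOn fc.hUopen (contDiffOn_spray (fc := fc) j) hp
  have hyd (k : Fin n) : DifferentiableAt ℝ (fun q : Pt n => q.2 k) p :=
    (hasFDerivAt_fibre k p).differentiableAt
  have hcontract : ∀ q ∈ fc.U,
      ∑ j, pd (ey j) e q * fc.spray j q = (1/2) * ∑ k, q.2 k * pd (ex k) e q := by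
    intro q hq
    have h1 : ∑ j, pd (ey j) e q * fc.spray j q
        = 2 * ∑ l, q.2 l * ∑ j, fc.g l j q * fc.spray j q := by
      simp_rw [Finset.mul_sum]
      rw [Finset.sum_comm]
      refine Finset.sum_congr rfl fun j _ => ?_
      have := sum_g_fibre j hq
      rw [← he] at this
      rw [show pd (ey j) e q = 2 * ∑ l, q.2 l * fc.g l j q by rw [this]; ring, mul_assoc,
        Finset.sum_mul, Finset.mul_sum]
      exact Finset.sum_congr rfl fun l _ => by ring
    have h2 : ∑ l, q.2 l * loweredSpray fc l q = ∑ k, q.2 k * pd (ex k) e q := by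
      have h3 : ∑ l, q.2 l * ∑ k, pd (ey l) (pd (ex k) e) q * q.2 k
          = ∑ k, q.2 k * (2 * pd (ex k) e q) := by
        simp_rw [Finset.mul_sum]
        rw [Finset.sum_comm]
        refine Finset.sum_congr rfl fun k _ => ?_
        rw [← eulerHom_sq_F.pd_ex fc.hUopen contDiffOn_sq_F k q hq, pd_LV, Finset.mul_sum]
        exact Finset.sum_congr rfl fun l _ => by ring
      simp only [loweredSpray, mul_sub, Finset.sum_sub_distrib]
      rw [← he, h3, ← Finset.sum_sub_distrib]
      exact Finset.sum_congr rfl fun l _ => by ring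
    rw [h1, ← h2, Finset.mul_sum, Finset.mul_sum]
    refine Finset.sum_congr rfl fun l _ => ?_
    rw [sum_g_spray l hq]
    ring
  have h := pd_congr fc.hUopen hcontract (ey i) hp
  rw [pd_sum_mul (fun j => hd _) hG, pd_const_mul (DifferentiableAt.fun_sum fun k _ =>
    (hyd k).fun_mul (hd _)), pd_sum_mul hyd (fun j => hd _)] at h
  simp only [pd_fibre, Finset.sum_add_distrib] at h
  have h1 : ∑ j, pd (ey i) (pd (ey j) e) p * fc.spray j p
      = 2 * ((1/4) * loweredSpray fc i p) := by
    rw [← sum_g_spray i hp, Finset.mul_sum]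
    refine Finset.sum_congr rfl fun j _ => ?_
    rw [fc.gdef i j p hp]; ring
  have h2 : ∑ j, (ey i : Pt n).2 j * pd (ex j) e p = pd (ex i) e p := by
    simp [ey, Pi.single_apply]
  have h3 : ∑ j, pd (ey j) e p * pd (ey i) (fc.spray j) p
      = ∑ j, fc.N i j p * pd (ey j) e p :=
    Finset.sum_congr rfl fun j _ => by rw [fc.Ndef i j p hp]; ring
  have h4 : loweredSpray fc i p
      = ∑ k, p.2 k * pd (ey i) (pd (ex k) e) p - pd (ex i) e p := by
    unfold loweredSpray
    simp_rw [mul_comm (p.2 _)]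
    rfl
  rw [h1, h2, h3] at h
  linarith

lemma dely_LV (i : Fin n) (p : Pt n) : dely fc i p (LV p) = p.2 i := by
  simp [dely, LV]

lemma Gs_LV (p v : Pt n) :
    Gs fc p v (LV p) = ∑ i, ∑ j, fc.g i j p * (dely fc i p v * p.2 j) := by
  simp only [Gs, dely_LV]; simp [LV]

/-- `G(·, L) = ½ dF²`. -/
lemma two_mul_Gs_LV {p : Pt n} (hp : p ∈ fc.U) (v : Pt n) :
    2 * Gs fc p v (LV p) = pd v (fun q => fc.F q ^ 2) p := by
  have h1 : 2 * Gs fc p v (LV p) = ∑ i, dely fc i p v * pd (ey i) (fun q => fc.F q ^ 2) p := by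
    rw [Gs_LV, Finset.mul_sum]
    refine Finset.sum_congr rfl fun i _ => ?_
    have h := sum_g_fibre i hp
    rw [show pd (ey i) (fun q => fc.F q ^ 2) p = 2 * ∑ j, p.2 j * fc.g j i p by rw [h]; ring]
    simp_rw [Finset.mul_sum]
    exact Finset.sum_congr rfl fun j _ => by rw [fc.gsymm i j p hp]; ring
  rw [h1, pd_eq_sum]
  simp_rw [pd_ex_sq_F _ hp, dely, add_mul, Finset.sum_add_distrib, Finset.sum_mul, Finset.mul_sum]
  rw [add_comm, Finset.sum_comm]
  congr 1
  exact Finset.sum_congr rfl fun i _ => Finset.sum_congr rfl fun j _ => by ring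

lemma Gs_LV_LV {p : Pt n} (hp : p ∈ fc.U) : Gs fc p (LV p) (LV p) = fc.F p ^ 2 := by
  have h1 := two_mul_Gs_LV hp (LV p)
  rw [eulerHom_sq_F p hp] at h1
  linarith

lemma Gs_lie_LV_eq_zero {X Y : VF n} (hX : ContDiffOn ℝ (⊤ : ℕ∞) X fc.U)
    (hY : ContDiffOn ℝ (⊤ : ℕ∞) Y fc.U) (hXL : ∀ q ∈ fc.U, Gs fc q (X q) (LV q) = 0)
    (hYL : ∀ q ∈ fc.U, Gs fc q (Y q) (LV q) = 0) {p : Pt n} (hp : p ∈ fc.U) :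
    Gs fc p (lie X Y p) (LV p) = 0 := by
  have h := two_mul_Gs_LV hp (lie X Y p)
  rw [fderiv_lie_eq_zero fc.hUopen contDiffOn_sq_F hX hY
    (fun q hq => (two_mul_Gs_LV hq (X q)).symm.trans (by rw [hXL q hq, mul_zero]))
    (fun q hq => (two_mul_Gs_LV hq (Y q)).symm.trans (by rw [hYL q hq, mul_zero])) hp] at h
  linarith

lemma fst_fderiv {X : VF n} {p : Pt n} (hX : DifferentiableAt ℝ X p) (v : Pt n) (i : Fin n) :
    (fderiv ℝ X p v).1 i = pd v (fun q => (X q).1 i) p := by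
  have h : HasFDerivAt (fun q => (X q).1 i) _ p :=
    (hasFDerivAt_base i (X p)).comp p hX.hasFDerivAt
  rw [pd, h.fderiv]; rfl

lemma snd_fderiv {X : VF n} {p : Pt n} (hX : DifferentiableAt ℝ X p) (v : Pt n) (i : Fin n) :
    (fderiv ℝ X p v).2 i = pd v (fun q => (X q).2 i) p := by
  have h : HasFDerivAt (fun q => (X q).2 i) _ p :=
    (hasFDerivAt_fibre i (X p)).comp p hX.hasFDerivAt
  rw [pd, h.fderiv]; rfl

lemma differentiableAt_fst {X : VF n} {p : Pt n} (hX : DifferentiableAt ℝ X p) (i : Fin n) :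
    DifferentiableAt ℝ (fun q => (X q).1 i) p :=
  ((hasFDerivAt_base i (X p)).comp p hX.hasFDerivAt).differentiableAt

lemma differentiableAt_snd {X : VF n} {p : Pt n} (hX : DifferentiableAt ℝ X p) (i : Fin n) :
    DifferentiableAt ℝ (fun q => (X q).2 i) p :=
  ((hasFDerivAt_fibre i (X p)).comp p hX.hasFDerivAt).differentiableAt

lemma lie_LV_fst {X : VF n} {p : Pt n} (hX : DifferentiableAt ℝ X p) (i : Fin n) :
    (lie X LV p).1 i = -pd (LV p) (fun q => (X q).1 i) p := by
  simp [lie, fderiv_LV, fst_fderiv hX]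

lemma lie_LV_snd {X : VF n} {p : Pt n} (hX : DifferentiableAt ℝ X p) (i : Fin n) :
    (lie X LV p).2 i = (X p).2 i - pd (LV p) (fun q => (X q).2 i) p := by
  simp [lie, fderiv_LV, snd_fderiv hX]

lemma differentiableAt_dely {X : VF n} {p : Pt n} (hp : p ∈ fc.U) (hX : DifferentiableAt ℝ X p)
    (i : Fin n) : DifferentiableAt ℝ (fun q => dely fc i q (X q)) p :=
  (differentiableAt_snd hX i).add (DifferentiableAt.fun_sum fun j _ =>
    (differentiableAt_of_contDiffOn fc.hUopen (fc.Nsmooth j i) hp).mul (differentiableAt_fst hX j))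

/-- `δy^i([X, L]) = δy^i(X) − L(δy^i(X))`. -/
lemma dely_lie_LV {X : VF n} {p : Pt n} (hp : p ∈ fc.U) (hX : DifferentiableAt ℝ X p)
    (i : Fin n) : dely fc i p (lie X LV p)
      = dely fc i p (X p) - pd (LV p) (fun q => dely fc i q (X q)) p := by
  have hN (j : Fin n) := differentiableAt_of_contDiffOn fc.hUopen (fc.Nsmooth j i) hp
  have hs := DifferentiableAt.fun_sum (u := Finset.univ)
    fun j _ => (hN j).mul (differentiableAt_fst hX j)
  have h : pd (LV p) (fun q => dely fc i q (X q)) p = pd (LV p) (fun q => (X q).2 i) p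
      + ∑ j, (fc.N j i p * (X p).1 j + fc.N j i p * pd (LV p) (fun q => (X q).1 j) p) := by
    have h2 := pd_sum_mul hN (differentiableAt_fst hX) (LV p)
    simp only [eulerHom_N _ i p hp, one_mul] at h2
    rw [← h2]
    unfold pd dely
    exact congrArg (· (LV p)) (fderiv_fun_add (differentiableAt_snd hX i) hs)
  rw [h]
  simp only [dely, lie_LV_fst hX, lie_LV_snd hX, Finset.sum_add_distrib, mul_neg,
    Finset.sum_neg_distrib]
  ring

lemma pd_Gs {X Y : VF n} {p : Pt n} (hp : p ∈ fc.U) (hX : DifferentiableAt ℝ X p)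
    (hY : DifferentiableAt ℝ Y p) (v : Pt n) :
    pd v (fun q => Gs fc q (X q) (Y q)) p = ∑ i, ∑ j, (pd v (fc.g i j) p *
        ((X p).1 i * (Y p).1 j + dely fc i p (X p) * dely fc j p (Y p))
      + fc.g i j p * (pd v (fun q => (X q).1 i) p * (Y p).1 j
        + (X p).1 i * pd v (fun q => (Y q).1 j) p
        + (pd v (fun q => dely fc i q (X q)) p * dely fc j p (Y p)
        + dely fc i p (X p) * pd v (fun q => dely fc j q (Y q)) p))) := by
  have hg (i j : Fin n) := (differentiableAt_of_contDiffOn fc.hUopen (fc.gsmooth i j) hp).hasFDerivAt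
  have h := HasFDerivAt.fun_sum (u := Finset.univ) fun i _ =>
    HasFDerivAt.fun_sum (u := Finset.univ) fun j _ => (hg i j).mul
      (((differentiableAt_fst hX i).hasFDerivAt.mul (differentiableAt_fst hY j).hasFDerivAt).add
      ((differentiableAt_dely hp hX i).hasFDerivAt.mul (differentiableAt_dely hp hY j).hasFDerivAt))
  have h' : pd v (fun q => Gs fc q (X q) (Y q)) p = _ := congrArg (· v) h.fderiv
  rw [h']
  simp only [sum_apply, add_apply,
    smul_apply, smul_eq_mul, Pi.add_apply, Pi.mul_apply]
  refine Finset.sum_congr rfl fun i _ => Finset.sum_congr rfl fun j _ => ?_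
  simp only [pd]
  ring

/-- The Lie derivative of the Sasaki metric along `L` is twice its vertical part. -/
lemma lieDerivative_LV_Gs {X Y : VF n} {p : Pt n} (hp : p ∈ fc.U) (hX : DifferentiableAt ℝ X p)
    (hY : DifferentiableAt ℝ Y p) :
    pd (LV p) (fun q => Gs fc q (X q) (Y q)) p + Gs fc p (lie X LV p) (Y p)
      + Gs fc p (lie Y LV p) (X p)
      = 2 * ∑ i, ∑ j, fc.g i j p * (dely fc i p (X p) * dely fc j p (Y p)) := by
  have hsymm : Gs fc p (lie Y LV p) (X p) = Gs fc p (X p) (lie Y LV p) := by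
    unfold Gs
    rw [Finset.sum_comm]
    refine Finset.sum_congr rfl fun i _ => Finset.sum_congr rfl fun j _ => ?_
    rw [fc.gsymm i j p hp]; ring
  rw [hsymm, pd_Gs hp hX hY]
  unfold Gs
  simp only [← Finset.sum_add_distrib, Finset.mul_sum]
  refine Finset.sum_congr rfl fun i _ => Finset.sum_congr rfl fun j _ => ?_
  rw [eulerHom_g i j p hp, dely_lie_LV hp hX, dely_lie_LV hp hY, lie_LV_fst hX, lie_LV_fst hY]
  ring

/-- For fields orthogonal to `L`, the normal component of `∇_X Y` only sees the vertical parts. -/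
lemma Gs_nab_LV {nab : VF n → VF n → VF n} (hnab : IsLeviCivita fc nab) {X Y : VF n}
    (hX : ContDiffOn ℝ (⊤ : ℕ∞) X fc.U) (hY : ContDiffOn ℝ (⊤ : ℕ∞) Y fc.U)
    (hXL : ∀ q ∈ fc.U, Gs fc q (X q) (LV q) = 0) (hYL : ∀ q ∈ fc.U, Gs fc q (Y q) (LV q) = 0)
    {p : Pt n} (hp : p ∈ fc.U) : Gs fc p (nab X Y p) (LV p)
      = -∑ i, ∑ j, fc.g i j p * (dely fc i p (X p) * dely fc j p (Y p)) := by
  have hconst (w : Pt n) : pd w (fun _ : Pt n => (0 : ℝ)) p = 0 := by simp [pd]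
  have hK := hnab X Y LV hX hY contDiff_LV.contDiffOn p hp
  have h1 : Dv X (fun q => Gs fc q (Y q) (LV q)) p = 0 :=
    (pd_congr fc.hUopen hYL (X p) hp).trans (hconst _)
  have h2 : Dv Y (fun q => Gs fc q (X q) (LV q)) p = 0 :=
    (pd_congr fc.hUopen hXL (Y p) hp).trans (hconst _)
  have h3 := lieDerivative_LV_Gs hp (differentiableAt_of_contDiffOn fc.hUopen hX hp)
    (differentiableAt_of_contDiffOn fc.hUopen hY hp)
  have h4 : Dv LV (fun q => Gs fc q (X q) (Y q)) p
    = pd (LV p) (fun q => Gs fc q (X q) (Y q)) p := rfl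
  rw [h1, h2, h4, Gs_lie_LV_eq_zero hX hY hXL hYL hp] at hK
  linarith

lemma Gs_LV_eq_zero_of_dely {p v : Pt n} (hv : ∀ i, dely fc i p v = 0) :
    Gs fc p v (LV p) = 0 := by
  simp [Gs_LV, hv]

lemma dely_XI (i : Fin n) (p : Pt n) : dely fc i p (XI fc p) = 0 := by
  simp only [dely, XI, mul_comm (p.2 _)]
  ring

lemma dely_vb (E : Fin (n-1) → Fin n → Pt n → ℝ) (a : Fin (n-1)) (i : Fin n) (p : Pt n) :
    dely fc i p (vb E a p) = E a i p := by
  simp [dely, vb]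

lemma dely_hb (E : Fin (n-1) → Fin n → Pt n → ℝ) (a : Fin (n-1)) (i : Fin n) (p : Pt n) :
    dely fc i p (hb fc E a p) = 0 := by
  simp only [hb, Jm, dely_vb]
  simp [dely, vb, mul_comm]

lemma contDiffOn_XI : ContDiffOn ℝ (⊤ : ℕ∞) (XI fc) fc.U :=
  contDiff_snd.contDiffOn.prodMk (contDiffOn_pi.2 fun j => (ContDiffOn.sum fun i _ =>
    (contDiff_fibre i).contDiffOn.mul (fc.Nsmooth i j)).neg)

lemma contDiffOn_vb {E : Fin (n-1) → Fin n → Pt n → ℝ} (hE : IsAdaptedFrame fc E)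
    (a : Fin (n-1)) : ContDiffOn ℝ (⊤ : ℕ∞) (vb E a) fc.U :=
  contDiffOn_const.prodMk (contDiffOn_pi.2 fun i => hE.1 a i)

lemma contDiffOn_hb {E : Fin (n-1) → Fin n → Pt n → ℝ} (hE : IsAdaptedFrame fc E)
    (a : Fin (n-1)) : ContDiffOn ℝ (⊤ : ℕ∞) (hb fc E a) fc.U := by
  have h : hb fc E a = fun p => (fun i => E a i p, fun k => -(∑ i, E a i p * fc.N i k p)) := by
    funext p
    simp only [hb, Jm, dely_vb]
    simp [vb]
  rw [h]
  exact (contDiffOn_pi.2 fun i => hE.1 a i).prodMk (contDiffOn_pi.2 fun k =>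
    (ContDiffOn.sum fun i _ => (hE.1 a i).mul (fc.Nsmooth i k)).neg)

end Finsler

/-- Let `IM = {(x,y) ∈ TM : F(x,y) = 1}` be the indicatrix
bundle, a Riemannian submanifold of `(TM, G)` with restricted metric `Ḡ` and
induced Levi-Civita connection `∇̄` given by the Gauss formula
`∇_X Y = ∇̄_X Y + H(X,Y)` (with `H(X,Y)` the component of `∇_X Y` normal to
`IM`, i.e. along `L`).  Then the second fundamental form satisfies
`H(∂̄/∂̄y^a, ∂̄/∂̄y^b) = −(1/F²) g_{ab} L`, and `H` vanishes on all other
pairs among the frame vectors `δ̄/δ̄x^a, ξ, ∂̄/∂̄y^b`; equivalently `∇_X Y` is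
tangent to `IM` for all such pairs `(X,Y)` except `(∂̄/∂̄y^a, ∂̄/∂̄y^b)`, so
`∇̄` agrees with `∇` on those pairs. -/
theorem indicatrix_second_fundamental_form {n : ℕ} (fc : Chart n)
    (E : Fin (n-1) → Fin n → Pt n → ℝ) (hE : IsAdaptedFrame fc E)
    (nab nabBar : VF n → VF n → VF n) (hnab : IsLeviCivita fc nab)
    (hGauss : ∀ X Y : VF n, ∀ p ∈ fc.U, fc.F p = 1 →
      nabBar X Y p = nab X Y p - projL fc (nab X Y) p) :
    ∀ p ∈ fc.U, fc.F p = 1 → ∀ a b : Fin (n-1),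
      (projL fc (nab (vb E a) (vb E b)) p
        = (-(1 / fc.F p ^ 2) * gb fc E p a b) • LV p) ∧
      (Gs fc p (nab (hb fc E a) (hb fc E b) p) (LV p) = 0) ∧
      (Gs fc p (nab (hb fc E a) (vb E b) p) (LV p) = 0) ∧
      (Gs fc p (nab (vb E a) (hb fc E b) p) (LV p) = 0) ∧
      (Gs fc p (nab (hb fc E a) (XI fc) p) (LV p) = 0) ∧
      (Gs fc p (nab (XI fc) (hb fc E a) p) (LV p) = 0) ∧
      (Gs fc p (nab (vb E a) (XI fc) p) (LV p) = 0) ∧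
      (Gs fc p (nab (XI fc) (vb E a) p) (LV p) = 0) ∧
      (Gs fc p (nab (XI fc) (XI fc) p) (LV p) = 0) ∧
      (nabBar (hb fc E a) (hb fc E b) p = nab (hb fc E a) (hb fc E b) p) ∧
      (nabBar (hb fc E a) (vb E b) p = nab (hb fc E a) (vb E b) p) ∧
      (nabBar (vb E a) (hb fc E b) p = nab (vb E a) (hb fc E b) p) ∧
      (nabBar (hb fc E a) (XI fc) p = nab (hb fc E a) (XI fc) p) ∧
      (nabBar (XI fc) (hb fc E a) p = nab (XI fc) (hb fc E a) p) ∧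
      (nabBar (vb E a) (XI fc) p = nab (vb E a) (XI fc) p) ∧
      (nabBar (XI fc) (vb E a) p = nab (XI fc) (vb E a) p) ∧
      (nabBar (XI fc) (XI fc) p = nab (XI fc) (XI fc) p) := by
  intro p hp hF a b
  have hv := contDiffOn_vb hE
  have hh := contDiffOn_hb hE
  have hx := contDiffOn_XI (fc := fc)
  have hvL := hE.2.2
  have hhL (c : Fin (n-1)) : ∀ q ∈ fc.U, Gs fc q (hb fc E c q) (LV q) = 0 :=
    fun q _ => Gs_LV_eq_zero_of_dely fun i => dely_hb E c i q
  have hxL : ∀ q ∈ fc.U, Gs fc q (XI fc q) (LV q) = 0 :=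
    fun q _ => Gs_LV_eq_zero_of_dely fun i => dely_XI i q
  have hBar {X Y : VF n} (h : Gs fc p (nab X Y p) (LV p) = 0) : nabBar X Y p = nab X Y p := by
    rw [hGauss X Y p hp hF, projL, h]; simp
  have hvv : projL fc (nab (vb E a) (vb E b)) p
      = (-(1 / fc.F p ^ 2) * gb fc E p a b) • LV p := by
    have hgb : ∑ i, ∑ j, fc.g i j p * (E a i p * E b j p) = gb fc E p a b := by
      simp only [gb, mul_assoc]
    rw [projL, Gs_nab_LV hnab (hv a) (hv b) (hvL a) (hvL b) hp, Gs_LV_LV hp]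
    simp only [dely_vb, hgb]
    congr 1
    ring
  have h1 : Gs fc p (nab (hb fc E a) (hb fc E b) p) (LV p) = 0 := by
    rw [Gs_nab_LV hnab (hh a) (hh b) (hhL a) (hhL b) hp]; simp [dely_hb]
  have h2 : Gs fc p (nab (hb fc E a) (vb E b) p) (LV p) = 0 := by
    rw [Gs_nab_LV hnab (hh a) (hv b) (hhL a) (hvL b) hp]; simp [dely_hb]
  have h3 : Gs fc p (nab (vb E a) (hb fc E b) p) (LV p) = 0 := by
    rw [Gs_nab_LV hnab (hv a) (hh b) (hvL a) (hhL b) hp]; simp [dely_hb]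
  have h4 : Gs fc p (nab (hb fc E a) (XI fc) p) (LV p) = 0 := by
    rw [Gs_nab_LV hnab (hh a) hx (hhL a) hxL hp]; simp [dely_XI]
  have h5 : Gs fc p (nab (XI fc) (hb fc E a) p) (LV p) = 0 := by
    rw [Gs_nab_LV hnab hx (hh a) hxL (hhL a) hp]; simp [dely_XI]
  have h6 : Gs fc p (nab (vb E a) (XI fc) p) (LV p) = 0 := by
    rw [Gs_nab_LV hnab (hv a) hx (hvL a) hxL hp]; simp [dely_XI]
  have h7 : Gs fc p (nab (XI fc) (vb E a) p) (LV p) = 0 := by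
    rw [Gs_nab_LV hnab hx (hv a) hxL (hvL a) hp]; simp [dely_XI]
  have h8 : Gs fc p (nab (XI fc) (XI fc) p) (LV p) = 0 := by
    rw [Gs_nab_LV hnab hx hx hxL hxL hp]; simp [dely_XI]
  exact ⟨hvv, h1, h2, h3, h4, h5, h6, h7, h8, hBar h1, hBar h2, hBar h3, hBar h4, hBar h5,
    hBar h6, hBar h7, hBar h8⟩

end FinslerFoliations

end
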